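/- Let F = 𝔽_p(t)^perf with p > 3 prime. The fields F(√t) and F(√(t³+1)) are not elementarily equivalent as fields: the equation y² = x³ + 1 has a solution with x ∉ 𝔽_p in F(√(t³+1)) (namely (t, √(t³+1))) but every solution in F(√t) has coordinates in 𝔽_p. -/

import Mathlib

open FirstOrder

/-- A square equal to a cube in an integrally closed domain is a sixth power. -/
theorem IsIntegrallyClosed.exists_eq_sq_and_eq_cube {R : Type*} [CommRing R] [IsDomain R]
    [IsIntegrallyClosed R] {a b : R} (h : a ^ 2 = b ^ 3) (hb : b ≠ 0) :
    ∃ c, b = c ^ 2 ∧ a = c ^ 3 := by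
  have hdvd : b ∣ a := (IsIntegrallyClosed.pow_dvd_pow_iff two_ne_zero).1 ⟨b, by rw [h]; ring⟩
  obtain ⟨c, rfl⟩ := hdvd
  have hc : b = c ^ 2 := mul_left_cancel₀ (pow_ne_zero 2 hb) (by linear_combination -h)
  exact ⟨c, hc, by rw [hc]; ring⟩

/-- Away from characteristics `2` and `3`, the affine curve `y² = x³ + 1` has only constant points
over a rational function field. -/
theorem RatFunc.exists_eq_C_of_sq_eq_cube_add_one {k : Type*} [Field k] (h2 : (2 : k) ≠ 0)
    (h3 : (3 : k) ≠ 0) {x y : RatFunc k} (h : y ^ 2 = x ^ 3 + 1) : ∃ c : k, x = RatFunc.C c := by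
  classical
  have hxd := x.denom_ne_zero
  have hyd := y.denom_ne_zero
  have key : y.num ^ 2 * x.denom ^ 3 = y.denom ^ 2 * (x.num ^ 3 + x.denom ^ 3) := by
    apply RatFunc.algebraMap_injective k
    have hxd' := RatFunc.algebraMap_ne_zero hxd
    have hyd' := RatFunc.algebraMap_ne_zero hyd
    rw [← x.num_div_denom, ← y.num_div_denom] at h
    field_simp at h
    simp only [map_mul, map_add, map_pow]
    linear_combination h
  have hxc := x.isCoprime_num_denom
  have hyc := y.isCoprime_num_denom
  have hden : y.denom ^ 2 = x.denom ^ 3 := by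
    refine Polynomial.eq_of_monic_of_associated (y.monic_denom.pow 2) (x.monic_denom.pow 3)
      (associated_of_dvd_dvd ?_ ?_)
    · exact (hyc.pow (m := 2) (n := 2)).symm.dvd_of_dvd_mul_left ⟨_, key⟩
    · have hcop : IsCoprime (x.denom ^ 3) (x.num ^ 3 + x.denom ^ 3) := by
        simpa using (hxc.pow (m := 3) (n := 3)).symm.add_mul_left_right 1
      exact hcop.dvd_of_dvd_mul_right ⟨y.num ^ 2, by rw [← key]; ring⟩
  obtain ⟨c, hxc2, hyc3⟩ := IsIntegrallyClosed.exists_eq_sq_and_eq_cube hden hxd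
  have hc0 : c ≠ 0 := by rintro rfl; simp at hxc2; exact hxd hxc2
  have key2 : y.num ^ 2 = x.num ^ 3 + c ^ 6 := by
    rw [hden, mul_comm] at key
    rw [mul_left_cancel₀ (pow_ne_zero 3 hxd) key, hxc2]; ring
  have hcop : IsCoprime x.num c := by
    rw [hxc2] at hxc
    exact (IsCoprime.pow_right_iff two_pos).1 hxc
  suffices hdeg : x.num.natDegree = 0 ∧ c.natDegree = 0 by
    obtain ⟨⟨a, ha⟩, b, hb⟩ :=
      hdeg.imp Polynomial.natDegree_eq_zero.1 Polynomial.natDegree_eq_zero.1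
    refine ⟨a / b ^ 2, ?_⟩
    rw [← x.num_div_denom, hxc2, ← ha, ← hb]
    simp
  by_cases hx0 : x.num = 0
  · rw [hx0, isCoprime_zero_left] at hcop
    exact ⟨by simp [hx0], Polynomial.natDegree_eq_zero_of_isUnit hcop⟩
  by_cases hy0 : y.num = 0
  · have hcu : IsUnit c := by
      refine hcop.isUnit_of_dvd' ?_ dvd_rfl
      refine (IsIntegrallyClosed.pow_dvd_pow_iff three_ne_zero).1 ⟨-c ^ 3, ?_⟩
      rw [hy0] at key2
      linear_combination -key2
    have hxu : IsUnit x.num := by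
      refine isUnit_of_dvd_unit ⟨-x.num ^ 2, ?_⟩ (hcu.pow 6)
      rw [hy0] at key2
      linear_combination -key2
    exact ⟨Polynomial.natDegree_eq_zero_of_isUnit hxu, Polynomial.natDegree_eq_zero_of_isUnit hcu⟩
  · have h6 : (6 : k) ≠ 0 := by
      rw [show (6 : k) = 2 * 3 by norm_num]
      exact mul_ne_zero h2 h3
    have := Polynomial.flt_catalan (p := 3) (q := 6) (r := 2) (by simp) (by simp) (by simp)
      (by simp) (by exact_mod_cast h3) (by exact_mod_cast h6) (by exact_mod_cast h2)
      hx0 hc0 hy0 hcop (u := 1) (v := 1) (w := -1) one_ne_zero one_ne_zero (by simp)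
      (by simp [key2])
    exact ⟨this.1, this.2.1⟩

theorem pow_eq_self_of_sq_eq_cube_add_one_of_pow_mem_range {p : ℕ} [Fact p.Prime] (hp : 3 < p)
    {L : Type*} [Field L] [CharP L p] (φ : RatFunc (ZMod p) →+* L) {x y : L}
    (hx : ∃ n : ℕ, x ^ p ^ n ∈ φ.range) (hy : ∃ n : ℕ, y ^ p ^ n ∈ φ.range)
    (h : y ^ 2 = x ^ 3 + 1) : x ^ p = x := by
  obtain ⟨n, f, hf⟩ := hx
  obtain ⟨m, g, hg⟩ := hy
  have heq : (g ^ p ^ n) ^ 2 = (f ^ p ^ m) ^ 3 + 1 := by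
    apply φ.injective
    have := congrArg (iterateFrobenius L p (n + m)) h
    simp only [map_add, map_pow, map_one, iterateFrobenius_def] at this
    simp only [map_add, map_pow, map_one, hf, hg]
    rw [← pow_mul x, ← pow_mul y, ← pow_add, ← pow_add, add_comm m n]
    exact this
  have hne (q : ℕ) (hq : 0 < q) (hqp : q < p) : (q : ZMod p) ≠ 0 := by
    rw [Ne, ZMod.natCast_eq_zero_iff]
    exact Nat.not_dvd_of_pos_of_lt hq hqp
  obtain ⟨c, hc⟩ := RatFunc.exists_eq_C_of_sq_eq_cube_add_one
    (by exact_mod_cast hne 2 (by lia) (by lia)) (by exact_mod_cast hne 3 (by lia) hp) heq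
  have hfix : (f ^ p ^ m) ^ p = f ^ p ^ m := by rw [hc, ← map_pow, ZMod.pow_card]
  apply iterateFrobenius_inj L p (n + m)
  have hx : x ^ p ^ (n + m) = φ (f ^ p ^ m) := by
    rw [map_pow, hf, ← pow_mul, ← pow_add]
  rw [map_pow, iterateFrobenius_def, hx, ← map_pow, hfix]

/-- A homomorphism from `k(t)` factors, up to its image, through adjoining a square root of `t`. -/
theorem RatFunc.exists_ringHom_X_eq_of_sq_eq {k L : Type*} [Field k] [Field L]
    (ψ : RatFunc k →+* L) {r : L} (hr : r ^ 2 = ψ RatFunc.X) :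
    ∃ φ : RatFunc k →+* L, φ RatFunc.X = r ∧ ψ.fieldRange ≤ φ.fieldRange := by
  let : Algebra k L := (ψ.comp RatFunc.C).toAlgebra
  let ψ' : RatFunc k →ₐ[k] L :=
    { ψ with
      commutes' := fun a => by simp [RingHom.algebraMap_toAlgebra, RatFunc.algebraMap_eq_C] }
  have htr : Transcendental k r := by
    intro halg
    have h2 : IsAlgebraic k (ψ' RatFunc.X) := by
      have := halg.pow 2
      rw [hr] at this
      exact this
    exact RatFunc.transcendental_X ((isAlgebraic_algHom_iff ψ' ψ'.injective).1 h2)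
  have hinj : Function.Injective (Polynomial.aeval (R := k) r) :=
    transcendental_iff_injective.1 htr
  let φ := RatFunc.liftAlgHom (Polynomial.aeval (R := k) r)
    (nonZeroDivisors_le_comap_nonZeroDivisors_of_injective _ hinj)
  have hX : φ RatFunc.X = r := by
    rw [← RatFunc.algebraMap_X]
    exact (RatFunc.liftRingHom_algebraMap _ _ _).trans (Polynomial.aeval_X r)
  refine ⟨φ.toRingHom, hX, ?_⟩
  have hpoly (P : Polynomial k) :
      ψ (algebraMap _ _ P) ∈ φ.toRingHom.fieldRange := by
    induction P using Polynomial.induction_on' with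
    | add P Q hP hQ => simpa only [map_add] using add_mem hP hQ
    | monomial n a =>
      rw [← Polynomial.C_mul_X_pow_eq_monomial, map_mul, map_pow, RatFunc.algebraMap_X,
        RatFunc.algebraMap_C, map_mul, map_pow, ← hr]
      refine mul_mem ⟨RatFunc.C a, ?_⟩ (pow_mem (pow_mem (RingHom.mem_fieldRange.2 ⟨RatFunc.X, hX⟩) 2) n)
      exact φ.commutes a
  rintro _ ⟨f, rfl⟩
  rw [← f.num_div_denom, map_div₀]
  exact div_mem (hpoly _) (hpoly _)

theorem pow_eq_self_of_sq_eq_cube_add_one_of_mem_adjoin {p : ℕ} [Fact p.Prime] (hp : 3 < p)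
    {F L : Type*} [Field F] [Field L] [CharP L p] [Algebra F L] (ι : RatFunc (ZMod p) →+* F)
    (hι : ∀ a : F, ∃ n : ℕ, a ^ p ^ n ∈ ι.range) {r : L}
    (hr : r ^ 2 = algebraMap F L (ι RatFunc.X)) {x y : L}
    (hx : x ∈ IntermediateField.adjoin F {r}) (hy : y ∈ IntermediateField.adjoin F {r})
    (h : y ^ 2 = x ^ 3 + 1) : x ^ p = x := by
  obtain ⟨φ, hφ, hle⟩ := RatFunc.exists_ringHom_X_eq_of_sq_eq ((algebraMap F L).comp ι) hr
  let : Algebra (RatFunc (ZMod p)) L := φ.toAlgebra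
  have : ExpChar (RatFunc (ZMod p)) p := φ.expChar φ.injective p
  have hmem {z : L} (hz : z ∈ IntermediateField.adjoin F {r}) :
      ∃ n : ℕ, z ^ p ^ n ∈ φ.range := by
    refine (mem_perfectClosure_iff_pow_mem p (F := RatFunc (ZMod p))).1 ?_
    induction hz using IntermediateField.adjoin_induction with
    | mem z hz =>
      rw [Set.mem_singleton_iff.1 hz, ← hφ]
      exact algebraMap_mem (perfectClosure (RatFunc (ZMod p)) L) RatFunc.X
    | algebraMap a =>
      obtain ⟨n, f, hf⟩ := hι a
      refine (mem_perfectClosure_iff_pow_mem p).2 ⟨n, ?_⟩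
      rw [← map_pow, ← hf]
      exact hle ⟨f, rfl⟩
    | add _ _ _ _ hx hy => exact add_mem hx hy
    | inv _ _ hx => exact inv_mem hx
    | mul _ _ _ _ hx hy => exact mul_mem hx hy
  exact pow_eq_self_of_sq_eq_cube_add_one_of_pow_mem_range hp φ (hmem hx) (hmem hy) h

theorem PerfectClosure.exists_pow_mem_range_of (K : Type*) [CommRing K] (p : ℕ) [Fact p.Prime]
    [CharP K p] (a : PerfectClosure K p) : ∃ n : ℕ, a ^ p ^ n ∈ (PerfectClosure.of K p).range := by
  induction a using PerfectClosure.induction_on with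
  | _ z =>
    refine ⟨z.1, z.2, ?_⟩
    rw [← PerfectClosure.iterate_frobenius_mk K p z.1 z.2, ← coe_iterateFrobenius, iterateFrobenius_def]

/-- The sentence asserting that the abscissa of every point of `y² = x³ + 1` is fixed by
`x ↦ x ^ p`. -/
noncomputable def abscissaPowEqSelfSentence (p : ℕ) : Language.ring.Sentence :=
  let x : FreeCommRing (Empty ⊕ Fin 2) := FreeCommRing.of (Sum.inr 0)
  let y : FreeCommRing (Empty ⊕ Fin 2) := FreeCommRing.of (Sum.inr 1)
  Language.BoundedFormula.all <| Language.BoundedFormula.all <|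
    ((Ring.termOfFreeCommRing (y ^ 2)).bdEqual (Ring.termOfFreeCommRing (x ^ 3 + 1))).imp
      ((Ring.termOfFreeCommRing (x ^ p)).bdEqual (Ring.termOfFreeCommRing x))

theorem realize_abscissaPowEqSelfSentence (p : ℕ) {R : Type*} [CommRing R]
    [Ring.CompatibleRing R] :
    R ⊨ abscissaPowEqSelfSentence p ↔ ∀ x y : R, y ^ 2 = x ^ 3 + 1 → x ^ p = x := by
  simp [abscissaPowEqSelfSentence, Language.Sentence.Realize, Language.Formula.Realize, Fin.snoc]

/-- Let `F = 𝔽_p(t)^perf` with `p > 3` prime. The quadratic extensions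
`F(√t)` and `F(√(t³+1))` (realized inside an algebraic closure of `F` by adjoining square
roots `r₁` of `t` and `r₂` of `t³+1`) are not elementarily equivalent as fields (in the
first-order language of rings). -/
theorem adjoin_sqrt_t_not_elementarily_equivalent_adjoin_sqrt_t_cubed_add_one
    (p : ℕ) [Fact p.Prime] (hp : 3 < p) [CharP (RatFunc (ZMod p)) p]
    (r₁ r₂ : AlgebraicClosure (PerfectClosure (RatFunc (ZMod p)) p))
    (h₁ : r₁ ^ 2 = algebraMap (PerfectClosure (RatFunc (ZMod p)) p) _
            (PerfectClosure.of (RatFunc (ZMod p)) p RatFunc.X))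
    (h₂ : r₂ ^ 2 = algebraMap (PerfectClosure (RatFunc (ZMod p)) p) _
            (PerfectClosure.of (RatFunc (ZMod p)) p (RatFunc.X ^ 3 + 1))) :
    ¬ @Language.ElementarilyEquivalent Language.ring
        (IntermediateField.adjoin (PerfectClosure (RatFunc (ZMod p)) p) {r₁})
        (IntermediateField.adjoin (PerfectClosure (RatFunc (ZMod p)) p) {r₂})
        (Ring.compatibleRingOfRing _).toStructure
        (Ring.compatibleRingOfRing _).toStructure := by
  intro hequiv
  let := Ring.compatibleRingOfRing
    (IntermediateField.adjoin (PerfectClosure (RatFunc (ZMod p)) p) {r₁})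
  let := Ring.compatibleRingOfRing
    (IntermediateField.adjoin (PerfectClosure (RatFunc (ZMod p)) p) {r₂})
  have : CharP (AlgebraicClosure (PerfectClosure (RatFunc (ZMod p)) p)) p :=
    charP_of_injective_algebraMap (algebraMap (PerfectClosure (RatFunc (ZMod p)) p) _).injective p
  have hfirst := (realize_abscissaPowEqSelfSentence p
      (R := IntermediateField.adjoin (PerfectClosure (RatFunc (ZMod p)) p) {r₁})).2 fun x y hxy =>
    Subtype.ext <| pow_eq_self_of_sq_eq_cube_add_one_of_mem_adjoin hp
      (PerfectClosure.of (RatFunc (ZMod p)) p)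
      (PerfectClosure.exists_pow_mem_range_of _ p) h₁ x.2 y.2 (congrArg Subtype.val hxy)
  have hsecond := (realize_abscissaPowEqSelfSentence p).1
    ((Language.elementarilyEquivalent_iff.1 hequiv _).1 hfirst)
  have hX := congrArg Subtype.val <| hsecond
    (algebraMap _ _ (PerfectClosure.of (RatFunc (ZMod p)) p RatFunc.X))
    ⟨r₂, IntermediateField.mem_adjoin_simple_self _ r₂⟩
    (Subtype.ext (h₂.trans (by simp)))
  have hXp : (RatFunc.X : RatFunc (ZMod p)) ^ p = RatFunc.X := by
    apply ((algebraMap (PerfectClosure (RatFunc (ZMod p)) p)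
      (AlgebraicClosure (PerfectClosure (RatFunc (ZMod p)) p))).comp
        (PerfectClosure.of (RatFunc (ZMod p)) p)).injective
    rw [map_pow]
    exact hX
  rw [← RatFunc.algebraMap_X, ← map_pow] at hXp
  have hdeg := congrArg Polynomial.natDegree (RatFunc.algebraMap_injective (ZMod p) hXp)
  rw [Polynomial.natDegree_X_pow, Polynomial.natDegree_X] at hdeg
  lia
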